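/- Assume the principle (⌐) holds. Then there exists a sequence ⟨A_γ : γ < ω₂⟩ of unbounded subsets of ω₁ such that for all δ < γ < ω₂ the intersection A_γ ∩ A_δ is finite. -/

import Mathlib

noncomputable def w1 : Ordinal.{0} := (Cardinal.aleph 1).ord
noncomputable def w2 : Ordinal.{0} := (Cardinal.aleph 2).ord

/-- The agreement set of `x` and `y` with respect to the pair-coloring `c`,
computed within the domain `D`. -/
def agreeSet (c : Ordinal.{0} → Ordinal.{0} → Ordinal.{0}) (D : Set Ordinal.{0}) (x y : Ordinal.{0}) :
    Set Ordinal.{0} :=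
  {z | z ∈ D ∧ z ≠ x ∧ z ≠ y ∧ c x z = c y z}

/-- `m` is a monotone map from finite subsets of `θ` to finite subsets of `θ`. -/
def IsMonotoneMap (θ : Ordinal.{0}) (m : Set Ordinal.{0} → Set Ordinal.{0}) : Prop :=
  ∀ a : Set Ordinal.{0}, a.Finite → a ⊆ Set.Iio θ → a ⊆ m a ∧ (m a).Finite ∧ m a ⊆ Set.Iio θ

/-- The diagonalization principle (⌐). -/
def PrincipleDiag : Prop :=
  ∀ f : Ordinal.{0} → Ordinal.{0} → Ordinal.{0},
    (∀ α < w1, ∀ β < w1, f α β < w1) →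
    ∀ F : Set Ordinal.{0}, F.Finite → F ⊆ Set.Iio w1 →
      ∀ m : Set Ordinal.{0} → Set Ordinal.{0}, IsMonotoneMap w1 m →
        ∃ g : Ordinal.{0} → Ordinal.{0},
          (∀ β < w1, g β < w1) ∧
          (∀ β < w1, g β ∉ F) ∧
          ∀ a : Set Ordinal.{0}, a.Finite → a ⊆ Set.Iio w1 →
            ∃ b : Set Ordinal.{0}, b.Finite ∧ a ⊆ b ∧ b ⊆ Set.Iio w1 ∧
              ∀ α ∈ m b, ∀ β < w1, f α β = g β → β ∈ m b

theorem w1_mk : Cardinal.mk (Set.Iio w1) = Cardinal.aleph.{1} 1 := by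
  rw [Cardinal.mk_Iio_ordinal]; simp [w1]

theorem mk_Iio_le (γ : Ordinal.{0}) (h : γ < w2) :
    Cardinal.mk (Set.Iio γ) ≤ Cardinal.mk (Set.Iio w1) := by
  have h1 : γ.card < Cardinal.aleph 2 := Cardinal.lt_ord.1 h
  have h2 : γ.card ≤ Cardinal.aleph 1 := by
    rw [show (2 : Ordinal.{0}) = Order.succ 1 by
      rw [← Ordinal.add_one_eq_succ]; norm_num, Cardinal.aleph_succ] at h1
    exact Order.lt_succ_iff.1 h1
  rw [Cardinal.mk_Iio_ordinal, Cardinal.mk_Iio_ordinal, Cardinal.lift_le]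
  simpa [w1] using h2

theorem w1_pos : 0 < w1 := by
  rw [w1, Cardinal.lt_ord]; simp [Cardinal.aleph_pos]

theorem step (hdiag : PrincipleDiag) (γ : Ordinal.{0})
    (G : ∀ δ, δ < γ → Ordinal.{0} → Ordinal.{0}) :
    ∃ g : Ordinal.{0} → Ordinal.{0}, (∀ β < w1, g β < w1) ∧
      (γ < w2 → ∀ δ hδ, (∀ β < w1, G δ hδ β < w1) → {β | β < w1 ∧ G δ hδ β = g β}.Finite) := by
  classical
  by_cases hγ : γ < w2
  swap
  · exact ⟨fun _ => 0, fun _ _ => w1_pos, fun h => absurd h hγ⟩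
  obtain ⟨i⟩ := Cardinal.le_def _ _ |>.1 (mk_Iio_le γ hγ)
  let f : Ordinal.{0} → Ordinal.{0} → Ordinal.{0} := fun α β =>
    if h : ∃ δ : Set.Iio γ, (i δ : Ordinal.{0}) = α then
      (if G h.choose.1 h.choose.2 β < w1 then G h.choose.1 h.choose.2 β else 0) else 0
  have hf : ∀ δ hδ β, f (i ⟨δ, hδ⟩) β = if G δ hδ β < w1 then G δ hδ β else 0 := by
    intro δ hδ β
    have h : ∃ δ' : Set.Iio γ, (i δ' : Ordinal.{0}) = i ⟨δ, hδ⟩ := ⟨_, rfl⟩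
    have hc : h.choose = ⟨δ, hδ⟩ := i.injective (Subtype.ext h.choose_spec)
    have : f (i ⟨δ, hδ⟩) β = if G h.choose.1 h.choose.2 β < w1 then
      G h.choose.1 h.choose.2 β else 0 := dif_pos h
    rw [this]
    simp only [hc]
  obtain ⟨g, hg, -, hb⟩ := hdiag f (by
    intro α _ β _
    simp only [f]
    split_ifs with h1 h2
    · exact h2
    · exact w1_pos
    · exact w1_pos) ∅ Set.finite_empty (Set.empty_subset _) id
    (fun a h1 h2 => ⟨subset_rfl, h1, h2⟩)
  refine ⟨g, hg, fun _ δ hδ hG => ?_⟩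
  obtain ⟨b, hbf, hab, -, h⟩ := hb {(i ⟨δ, hδ⟩ : Ordinal.{0})} (Set.finite_singleton _)
    (Set.singleton_subset_iff.2 (i ⟨δ, hδ⟩).2)
  refine hbf.subset fun β hβ => h _ (hab rfl) β hβ.1 ?_
  exact (hf δ hδ β).trans ((if_pos (hG β hβ.1)).trans hβ.2)

theorem stmt_6 (hdiag : PrincipleDiag) :
    ∃ A : Ordinal.{0} → Set Ordinal.{0},
      (∀ γ < w2, A γ ⊆ Set.Iio w1) ∧
      (∀ γ < w2, ∀ α < w1, ∃ β ∈ A γ, α ≤ β) ∧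
      ∀ δ γ, δ < γ → γ < w2 → (A γ ∩ A δ).Finite := by
  choose s hs1 hs2 using step hdiag
  let g : Ordinal.{0} → Ordinal.{0} → Ordinal.{0} :=
    (wellFounded_lt (α := Ordinal.{0})).fix s
  have hg : ∀ γ, g γ = s γ (fun δ _ => g δ) := fun γ => WellFounded.fix_eq _ _ _
  have hg1 : ∀ γ, ∀ β < w1, g γ β < w1 := fun γ => by rw [hg]; exact hs1 _ _
  have hg2 : ∀ γ < w2, ∀ δ < γ, {β | β < w1 ∧ g δ β = g γ β}.Finite := by
    intro γ hγ δ hδ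
    rw [hg γ]
    exact hs2 γ (fun δ _ => g δ) hγ δ hδ (hg1 δ)
  have hp : Cardinal.mk (Set.Iio w1 × Set.Iio w1) ≤ Cardinal.mk (Set.Iio w1) := by
    rw [Cardinal.mk_prod, Cardinal.lift_id, w1_mk, Cardinal.mul_eq_self (Cardinal.aleph0_le_aleph 1)]
  obtain ⟨p⟩ := Cardinal.le_def _ _ |>.1 hp
  let k : Ordinal.{0} → Set.Iio w1 → Set.Iio w1 := fun γ β => p (β, ⟨g γ β, hg1 γ β β.2⟩)
  have hk : ∀ γ δ β β', k γ β = k δ β' → β = β' ∧ g γ β = g δ β' := by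
    intro γ δ β β' h
    have := p.injective h
    exact ⟨congrArg Prod.fst this, congrArg (fun q => (q.2 : Ordinal.{0})) this⟩
  refine ⟨fun γ => Set.range fun β => (k γ β : Ordinal.{0}), ?_, ?_, ?_⟩
  · rintro γ - _ ⟨β, rfl⟩
    exact (k γ β).2
  · intro γ _ α hα
    by_contra! hcon
    have hle : Cardinal.mk (Set.Iio w1) ≤ Cardinal.mk (Set.Iio α) :=
      Cardinal.mk_le_of_injective (f := fun β => ⟨k γ β, hcon _ ⟨β, rfl⟩⟩) (by
        intro β β' h
        have h' : (k γ β : Ordinal.{0}) = k γ β' :=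
          congrArg (fun x : Set.Iio α => (x : Ordinal.{0})) h
        exact (hk γ γ β β' (Subtype.ext h')).1)
    rw [Cardinal.mk_Iio_ordinal, Cardinal.mk_Iio_ordinal, Cardinal.lift_le] at hle
    have : α.card < Cardinal.aleph 1 := Cardinal.lt_ord.1 hα
    simp only [w1, Cardinal.card_ord] at hle
    exact absurd hle (not_le.2 this)
  · intro δ γ hδ hγ
    have hfin : {β : Set.Iio w1 | g δ β = g γ β}.Finite := by
      refine Set.Finite.of_finite_image ((hg2 γ hγ δ hδ).subset ?_) Subtype.val_injective.injOn
      rintro _ ⟨β, hβ, rfl⟩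
      exact ⟨β.2, hβ⟩
    refine (hfin.image fun β => (k γ β : Ordinal.{0})).subset ?_
    rintro _ ⟨⟨β, rfl⟩, ⟨β', h⟩⟩
    have := hk _ _ _ _ (Subtype.ext h)
    obtain ⟨rfl, h2⟩ := this
    exact ⟨β', h2, rfl⟩
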